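/- Let ρ be a nonnegative measurable function on ℝ³ with ∫ρ = N < ∞ and C² := sup_{x∈ℝ³} ∫_{ℝ³} ρ(y)/|x−y|² dy < ∞. Then for every r > 0: D(ρ) ≤ (N/2)·C·( sup_{x∈ℝ³} ∫_{B(x,r)} ρ )^{1/2} + N²/(2r). -/

import Mathlib

open MeasureTheory Metric Filter
open scoped ENNReal

/-- The Coulomb energy `D(ρ) = (1/2)∫∫ ρ(x)ρ(y)/|x-y| dx dy`, with value in `[0,∞]`. -/
noncomputable def coulombEnergy (ρ : EuclideanSpace ℝ (Fin 3) → ℝ) : ℝ≥0∞ :=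
  (1/2) * ∫⁻ x, ∫⁻ y, ENNReal.ofReal (ρ x * ρ y / ‖x - y‖)

/-- Cauchy–Schwarz for the splitting `ρ / |x - ·| = √ρ · (√ρ / |x - ·|)`. -/
theorem lintegral_div_norm_sub_le {E : Type*} [NormedAddCommGroup E] [MeasurableSpace E]
    [OpensMeasurableSpace E] {μ : Measure E} {ρ : E → ℝ} (hρ : AEMeasurable ρ μ)
    (hpos : ∀ x, 0 ≤ ρ x) (x : E) :
    ∫⁻ y, ENNReal.ofReal (ρ y / ‖x - y‖) ∂μ ≤
      (∫⁻ y, ENNReal.ofReal (ρ y) ∂μ) ^ (1 / 2 : ℝ) *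
        (∫⁻ y, ENNReal.ofReal (ρ y / ‖x - y‖ ^ 2) ∂μ) ^ (1 / 2 : ℝ) := by
  have hnorm : Measurable fun y : E => ‖x - y‖ :=
    (continuous_const.sub continuous_id).norm.measurable
  have h := ENNReal.lintegral_mul_le_Lp_mul_Lq μ Real.HolderConjugate.two_two
    (f := fun y => ENNReal.ofReal (√(ρ y))) (g := fun y => ENNReal.ofReal (√(ρ y) / ‖x - y‖))
    hρ.sqrt.ennreal_ofReal (hρ.sqrt.div hnorm.aemeasurable).ennreal_ofReal
  have hprod (y : E) : ((fun y => ENNReal.ofReal (√(ρ y))) *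
      fun y => ENNReal.ofReal (√(ρ y) / ‖x - y‖)) y = ENNReal.ofReal (ρ y / ‖x - y‖) := by
    rw [Pi.mul_apply, ← ENNReal.ofReal_mul (Real.sqrt_nonneg _), ← mul_div_assoc,
      Real.mul_self_sqrt (hpos y)]
  have hleft (y : E) : ENNReal.ofReal (√(ρ y)) ^ (2 : ℝ) = ENNReal.ofReal (ρ y) := by
    rw [ENNReal.rpow_two, ← ENNReal.ofReal_pow (Real.sqrt_nonneg _), Real.sq_sqrt (hpos y)]
  have hright (y : E) : ENNReal.ofReal (√(ρ y) / ‖x - y‖) ^ (2 : ℝ) =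
      ENNReal.ofReal (ρ y / ‖x - y‖ ^ 2) := by
    rw [ENNReal.rpow_two, ← ENNReal.ofReal_pow (by positivity), div_pow, Real.sq_sqrt (hpos y)]
  simpa only [hprod, hleft, hright] using h

/-- The Coulomb potential at `x`, split into the contributions of `B(x, r)` and its complement. -/
theorem lintegral_div_norm_sub_le_of_local_mass {E : Type*} [NormedAddCommGroup E]
    [MeasurableSpace E] [OpensMeasurableSpace E] {μ : Measure E} {ρ : E → ℝ}
    (hint : Integrable ρ μ) (hpos : ∀ x, 0 ≤ ρ x) {x : E} {C r S : ℝ} (hC : 0 ≤ C) (hr : 0 < r)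
    (hhardy : ∫⁻ y, ENNReal.ofReal (ρ y / ‖x - y‖ ^ 2) ∂μ ≤ ENNReal.ofReal (C ^ 2))
    (hS : ∫ y in ball x r, ρ y ∂μ ≤ S) :
    ∫⁻ y, ENNReal.ofReal (ρ y / ‖x - y‖) ∂μ ≤
      ENNReal.ofReal (C * √S + (∫ y, ρ y ∂μ) / r) := by
  have hS0 : 0 ≤ S := (integral_nonneg hpos).trans hS
  have hN0 : 0 ≤ ∫ y, ρ y ∂μ := integral_nonneg hpos
  have near : ∫⁻ y in ball x r, ENNReal.ofReal (ρ y / ‖x - y‖) ∂μ ≤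
      ENNReal.ofReal (C * √S) := by
    refine (lintegral_div_norm_sub_le hint.aemeasurable.restrict hpos x).trans ?_
    have hmass : ∫⁻ y in ball x r, ENNReal.ofReal (ρ y) ∂μ ≤ ENNReal.ofReal S := by
      rw [← ofReal_integral_eq_lintegral_ofReal hint.integrableOn (ae_of_all _ hpos)]
      exact ENNReal.ofReal_le_ofReal hS
    calc _ ≤ ENNReal.ofReal S ^ (1 / 2 : ℝ) * ENNReal.ofReal (C ^ 2) ^ (1 / 2 : ℝ) := by
          gcongr
          exact (setLIntegral_le_lintegral _ _).trans hhardy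
      _ = ENNReal.ofReal (C * √S) := by
          rw [ENNReal.ofReal_rpow_of_nonneg hS0 (by norm_num),
            ENNReal.ofReal_rpow_of_nonneg (sq_nonneg C) (by norm_num), ← Real.sqrt_eq_rpow,
            ← Real.sqrt_eq_rpow, Real.sqrt_sq hC, ← ENNReal.ofReal_mul (Real.sqrt_nonneg _),
            mul_comm]
  have far : ∫⁻ y in (ball x r)ᶜ, ENNReal.ofReal (ρ y / ‖x - y‖) ∂μ ≤
      ENNReal.ofReal ((∫ y, ρ y ∂μ) / r) := by
    rw [← integral_div, ofReal_integral_eq_lintegral_ofReal (hint.div_const r)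
      (ae_of_all _ fun y => div_nonneg (hpos y) hr.le)]
    refine (setLIntegral_mono' measurableSet_ball.compl fun y hy => ?_).trans
      (setLIntegral_le_lintegral _ _)
    have hy' : r ≤ ‖x - y‖ := by
      rw [← dist_eq_norm, dist_comm]
      simpa using hy
    exact ENNReal.ofReal_le_ofReal (div_le_div_of_nonneg_left (hpos y) hr hy')
  rw [← lintegral_add_compl _ (measurableSet_ball (x := x) (ε := r)),
    ENNReal.ofReal_add (by positivity) (by positivity)]
  exact add_le_add near far

/-- **Quantitative vanishing estimate.** For a nonnegative `ρ` on `ℝ³` with `∫ρ = N` and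
`sup_x ∫ ρ(y)/|x-y|² dy ≤ C²`, one has, for every `r > 0`,
`D(ρ) ≤ (N/2)·C·(sup_x ∫_{B(x,r)} ρ)^{1/2} + N²/(2r)`. -/
theorem coulombEnergy_le_of_local_mass
    (N C : ℝ) (hN : 0 ≤ N) (hC : 0 ≤ C)
    (ρ : EuclideanSpace ℝ (Fin 3) → ℝ)
    (hint : Integrable ρ) (hpos : ∀ x, 0 ≤ ρ x)
    (hmass : (∫ x, ρ x) = N)
    (hhardy : ∀ x : EuclideanSpace ℝ (Fin 3),
      (∫⁻ y, ENNReal.ofReal (ρ y / ‖x - y‖ ^ 2)) ≤ ENNReal.ofReal (C ^ 2))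
    (r : ℝ) (hr : 0 < r) :
    coulombEnergy ρ ≤
      ENNReal.ofReal
        ((N / 2) * C * Real.sqrt (⨆ x : EuclideanSpace ℝ (Fin 3), ∫ y in ball x r, ρ y)
          + N ^ 2 / (2 * r)) := by
  set S : ℝ := ⨆ x : EuclideanSpace ℝ (Fin 3), ∫ y in ball x r, ρ y
  have hbdd : BddAbove (Set.range fun x : EuclideanSpace ℝ (Fin 3) => ∫ y in ball x r, ρ y) := by
    refine ⟨N, ?_⟩
    rintro _ ⟨x, rfl⟩
    exact hmass ▸ setIntegral_le_integral hint (ae_of_all _ hpos)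
  have hinner (x : EuclideanSpace ℝ (Fin 3)) :
      ∫⁻ y, ENNReal.ofReal (ρ x * ρ y / ‖x - y‖) ≤
        ENNReal.ofReal (ρ x) * ENNReal.ofReal (C * √S + N / r) := by
    simp_rw [mul_div_assoc, ENNReal.ofReal_mul (hpos x)]
    rw [lintegral_const_mul' _ _ ENNReal.ofReal_ne_top, ← hmass]
    gcongr
    exact lintegral_div_norm_sub_le_of_local_mass hint hpos hC hr (hhardy x) (le_ciSup hbdd x)
  have hhalf : (1 / 2 : ℝ≥0∞) = ENNReal.ofReal (1 / 2) := by
    rw [ENNReal.ofReal_div_of_pos two_pos]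
    simp
  calc coulombEnergy ρ
      ≤ (1 / 2) * ∫⁻ x, ENNReal.ofReal (ρ x) * ENNReal.ofReal (C * √S + N / r) := by
        unfold coulombEnergy
        gcongr with x
        exact hinner x
    _ = ENNReal.ofReal ((N / 2) * C * √S + N ^ 2 / (2 * r)) := by
        rw [lintegral_mul_const' _ _ ENNReal.ofReal_ne_top,
          ← ofReal_integral_eq_lintegral_ofReal hint (ae_of_all _ hpos), hmass, hhalf,
          ← ENNReal.ofReal_mul hN, ← ENNReal.ofReal_mul (by norm_num)]
        congr 1
        field_simp
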